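/- arXiv:2411.00993 — 7 statements merged into one kernel-verified Lean document; each statement's English description precedes it below -/
import Mathlib

section
/- Let λ, λ', k be real numbers with 0 < λ < λ' and k > 0, set R := λ'/λ, and let K be a real number with K ≥ max{ 2^{λ'−λ} k, (1 + λ'/λ)^{λ'} k }. Let ρ ≥ 1 and define v⁺ : [0,∞) → ℝ by v⁺(r) = K ρ^{λ'−λ} r^{λ} for 0 ≤ r ≤ ρ, and v⁺(r) = K (1+R)^{−λ'} (r + Rρ)^{λ'} for r > ρ. Then v⁺(r) ≥ k r^{λ} (1+r)^{λ'−λ} for all r ≥ 0. -/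
/-- The radial supersolution barrier `v⁺` (inner profile `K ρ^{λ'-λ} r^λ` for `r ≤ ρ`,
outer profile `K (1+R)^{-λ'} (r + Rρ)^{λ'}` for `r > ρ`, where `R = λ'/λ`) dominates
`k r^λ (1+r)^{λ'-λ}` for all `r ≥ 0`, provided
`K ≥ max { 2^{λ'-λ} k, (1+λ'/λ)^{λ'} k }` and `ρ ≥ 1`. -/
theorem supersolution_ordering (lam lam' k K ρ R : ℝ)
    (hlam : 0 < lam) (hlam' : lam < lam') (hk : 0 < k)
    (hR : R = lam' / lam)
    (hK : max (2 ^ (lam' - lam) * k) ((1 + lam' / lam) ^ lam' * k) ≤ K)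
    (hρ : 1 ≤ ρ) (v : ℝ → ℝ)
    (hin : ∀ r : ℝ, 0 ≤ r → r ≤ ρ → v r = K * ρ ^ (lam' - lam) * r ^ lam)
    (hout : ∀ r : ℝ, ρ < r → v r = K * (1 + R) ^ (-lam') * (r + R * ρ) ^ lam') :
    ∀ r : ℝ, 0 ≤ r → k * r ^ lam * (1 + r) ^ (lam' - lam) ≤ v r := by
  intro r hr
  have hK1 := (le_max_left _ _).trans hK
  have hK2 := (le_max_right _ _).trans hK
  rw [← hR] at hK2
  have hR1 : 1 < R := by rw [hR, lt_div_iff₀ hlam]; linarith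
  have hd : 0 ≤ lam' - lam := by linarith
  rcases le_or_gt r ρ with h | h
  · rw [hin r hr h]
    have h1 : (1 + r) ^ (lam' - lam) ≤ 2 ^ (lam' - lam) * ρ ^ (lam' - lam) := by
      rw [← Real.mul_rpow (by norm_num) (by linarith)]
      exact Real.rpow_le_rpow (by linarith) (by linarith) hd
    have h2 : 0 ≤ r ^ lam := Real.rpow_nonneg hr _
    have h3 : 0 ≤ ρ ^ (lam' - lam) := Real.rpow_nonneg (by linarith) _
    calc k * r ^ lam * (1 + r) ^ (lam' - lam)
        ≤ k * r ^ lam * (2 ^ (lam' - lam) * ρ ^ (lam' - lam)) :=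
          mul_le_mul_of_nonneg_left h1 (by positivity)
      _ = (2 ^ (lam' - lam) * k) * (ρ ^ (lam' - lam) * r ^ lam) := by ring
      _ ≤ K * (ρ ^ (lam' - lam) * r ^ lam) :=
          mul_le_mul_of_nonneg_right hK1 (by positivity)
      _ = _ := by ring
  · rw [hout r h]
    have hp : 0 < (1 + R) ^ lam' := Real.rpow_pos_of_pos (by linarith) _
    have h1 : k ≤ K * (1 + R) ^ (-lam') := by
      rw [Real.rpow_neg (by linarith), ← div_eq_mul_inv, le_div_iff₀ hp]
      linarith
    have h0 : 0 ≤ (1 + r) ^ (lam' - lam) := Real.rpow_nonneg (by linarith) _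
    have h2 : r ^ lam * (1 + r) ^ (lam' - lam) ≤ (1 + r) ^ lam' := by
      calc r ^ lam * (1 + r) ^ (lam' - lam)
          ≤ (1 + r) ^ lam * (1 + r) ^ (lam' - lam) :=
            mul_le_mul_of_nonneg_right
              (Real.rpow_le_rpow hr (by linarith) hlam.le) h0
        _ = (1 + r) ^ lam' := by
            rw [← Real.rpow_add (by linarith)]; congr 1; ring
    have h3 : (1 + r) ^ lam' ≤ (r + R * ρ) ^ lam' :=
      Real.rpow_le_rpow (by linarith) (by nlinarith) (by linarith)
    have h4 : 0 ≤ (r + R * ρ) ^ lam' :=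
      Real.rpow_nonneg (by nlinarith) _
    rw [mul_assoc]
    exact (mul_le_mul_of_nonneg_left (h2.trans h3) hk.le).trans
      (mul_le_mul_of_nonneg_right h1 h4)
end

section
/- Let λ, λ' be real numbers with 0 < λ < λ', set R := λ'/λ, and let K > 0 and ρ > 0. Define f(r) := K ρ^{λ'−λ} r^{λ} and g(r) := K (1+R)^{−λ'} (r + Rρ)^{λ'} for r > 0. Then f(ρ) = g(ρ) and f'(ρ) − g'(ρ) = K ρ^{λ'−1} · λ²/(λ+λ') ≥ 0, where f' and g' denote derivatives. -/
/-- Matching condition for the piecewise radial supersolution: with `R = λ'/λ`,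
the inner profile `f(r) = K ρ^{λ'-λ} r^λ` and the outer profile
`g(r) = K (1+R)^{-λ'} (r + Rρ)^{λ'}` satisfy `f(ρ) = g(ρ)` and
`f'(ρ) - g'(ρ) = K ρ^{λ'-1} λ²/(λ+λ') ≥ 0`. -/
theorem supersolution_matching (lam lam' K ρ R : ℝ)
    (hlam : 0 < lam) (hlam' : lam < lam') (hK : 0 < K) (hρ : 0 < ρ)
    (hR : R = lam' / lam) :
    K * ρ ^ (lam' - lam) * ρ ^ lam = K * (1 + R) ^ (-lam') * (ρ + R * ρ) ^ lam' ∧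
    deriv (fun r : ℝ => K * ρ ^ (lam' - lam) * r ^ lam) ρ
        - deriv (fun r : ℝ => K * (1 + R) ^ (-lam') * (r + R * ρ) ^ lam') ρ
      = K * ρ ^ (lam' - 1) * lam ^ 2 / (lam + lam') ∧
    0 ≤ K * ρ ^ (lam' - 1) * lam ^ 2 / (lam + lam') := by
  have hl' : 0 < lam' := hlam.trans hlam'
  have hRp : 0 < 1 + R := by rw [hR]; positivity
  have hs : ρ + R * ρ = (1 + R) * ρ := by ring
  have hc : (1 + R) ^ (-lam') * (1 + R) ^ lam' = 1 := by
    rw [← Real.rpow_add hRp]; simp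
  refine ⟨?_, ?_, by positivity⟩
  · rw [hs, Real.mul_rpow hRp.le hρ.le, mul_assoc, ← Real.rpow_add hρ, sub_add_cancel]
    linear_combination (-K * ρ ^ lam') * hc
  · have h1 : HasDerivAt (fun r : ℝ => K * ρ ^ (lam' - lam) * r ^ lam)
        (K * ρ ^ (lam' - lam) * (lam * ρ ^ (lam - 1))) ρ :=
      (Real.hasDerivAt_rpow_const (Or.inl hρ.ne')).const_mul _
    have hne : ρ + R * ρ ≠ 0 := by rw [hs]; positivity
    have h2 : HasDerivAt (fun r : ℝ => K * (1 + R) ^ (-lam') * (r + R * ρ) ^ lam')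
        (K * (1 + R) ^ (-lam') * (1 * lam' * (ρ + R * ρ) ^ (lam' - 1))) ρ :=
      (((hasDerivAt_id ρ).add_const (R * ρ)).rpow_const (Or.inl hne)).const_mul _
    rw [h1.deriv, h2.deriv, hs, Real.mul_rpow hRp.le hρ.le]
    have e1 : ρ ^ (lam' - lam) * ρ ^ (lam - 1) = ρ ^ (lam' - 1) := by
      rw [← Real.rpow_add hρ]; congr 1; ring
    have e2 : (1 + R) ^ (-lam') * (1 + R) ^ (lam' - 1) = lam / (lam + lam') := by
      rw [← Real.rpow_add hRp, show -lam' + (lam' - 1) = -1 by ring, Real.rpow_neg_one, hR]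
      field_simp
    have e3 : lam - lam' * (lam / (lam + lam')) = lam ^ 2 / (lam + lam') := by
      field_simp; ring
    rw [mul_div_assoc, ← e3]
    linear_combination K * lam * e1 - K * lam' * ρ ^ (lam' - 1) * e2
end

section
/- Let n ≥ 2 be an integer, p > n, and let λ, λ' satisfy 0 < λ < (p−n)/(p−1) < λ' < 1; set θ := 1/(p−1−(p−2)λ'). Then there exists C_ξ ∈ (0,1), depending only on n, p, λ, λ', such that for all K ≥ 1, A ≥ 1, t ≥ 0 and 0 < r ≤ (1+At)^θ, the function w(s,τ) := K (1+Aτ)^{θ(λ'−λ)} s^{λ} satisfies ∂_τ w(r,t) − r^{1−n} · d/ds[ s^{n−1} (∂_s w(s,t))^{p−1} ]|_{s=r} − C_ξ (1+At)^{−1} ∂_r w(r,t) ≥ 0. Here ∂_τ w and ∂_s w denote the one-variable derivatives in τ and s respectively, and ∂_s w(s,t) = K (1+At)^{θ(λ'−λ)} λ s^{λ−1} > 0. -/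
/-- The inner barrier `w(s,τ) = K (1+Aτ)^{θ(λ'-λ)} s^λ` is a radial supersolution of
`∂_t v = Δ_p v + b(t)·∇v` for any drift with `|b(t)| ≤ C_ξ (1+At)^{-1}`, in the region
`0 < r ≤ (1+At)^θ`, where `θ = 1/(p-1-(p-2)λ')` and `0 < λ < (p-n)/(p-1) < λ' < 1`. -/
theorem inner_supersolution (n : ℕ) (p lam lam' θ : ℝ)
    (hn : 2 ≤ n) (hp : (n : ℝ) < p)
    (hlam0 : 0 < lam) (hlam1 : lam < (p - n) / (p - 1))
    (hlam2 : (p - n) / (p - 1) < lam') (hlam3 : lam' < 1)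
    (hθ : θ = 1 / (p - 1 - (p - 2) * lam')) :
    ∃ Cξ : ℝ, 0 < Cξ ∧ Cξ < 1 ∧
      ∀ K A t r : ℝ, 1 ≤ K → 1 ≤ A → 0 ≤ t → 0 < r → r ≤ (1 + A * t) ^ θ →
        0 ≤ deriv (fun τ : ℝ => K * (1 + A * τ) ^ (θ * (lam' - lam)) * r ^ lam) t
            - r ^ (1 - (n : ℝ))
                * deriv (fun s : ℝ => s ^ ((n : ℝ) - 1)
                    * (deriv (fun s' : ℝ =>
                        K * (1 + A * t) ^ (θ * (lam' - lam)) * s' ^ lam) s) ^ (p - 1)) r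
            - Cξ * (1 + A * t)⁻¹
                * deriv (fun s : ℝ => K * (1 + A * t) ^ (θ * (lam' - lam)) * s ^ lam) r := by
  have hn' : (2:ℝ) ≤ n := by exact_mod_cast hn
  have hp2 : 2 < p := by linarith
  have hp1 : 0 < p - 1 := by linarith
  have hθ0 : 0 < θ := by
    rw [hθ]
    apply one_div_pos.mpr
    nlinarith
  have hα : 0 < θ * (lam' - lam) := mul_pos hθ0 (by linarith)
  have hc : 0 < (1 - lam) * (p - 1) - (n - 1) := by
    rw [lt_div_iff₀ hp1] at hlam1
    nlinarith
  generalize θ * (lam' - lam) = α at hα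
  have hlp : 0 < lam ^ (p - 2) := Real.rpow_pos_of_pos hlam0 _
  have hl1 : lam < 1 := by linarith
  obtain ⟨c, hcdef⟩ : ∃ c, c = (1 - lam) * (p - 1) - (n - 1) := ⟨_, rfl⟩
  rw [← hcdef] at hc
  refine ⟨min (1/2) (min (α / lam) (c * lam ^ (p - 2))), by positivity,
    lt_of_le_of_lt (min_le_left _ _) (by norm_num), ?_⟩
  have hC1 : min (1/2) (min (α / lam) (c * lam ^ (p - 2))) ≤ α / lam :=
    (min_le_right _ _).trans (min_le_left _ _)
  have hC2 : min (1/2) (min (α / lam) (c * lam ^ (p - 2))) ≤ c * lam ^ (p - 2) :=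
    (min_le_right _ _).trans (min_le_right _ _)
  have hC0 : 0 < min (1/2) (min (α / lam) (c * lam ^ (p - 2))) := by positivity
  generalize min (1/2) (min (α / lam) (c * lam ^ (p - 2))) = C at hC1 hC2 hC0
  intro K A t r hK hA ht hr _
  have hT1 : 1 ≤ 1 + A * t := by nlinarith
  have hT : 0 < 1 + A * t := by linarith
  have hd1 : deriv (fun τ : ℝ => K * (1 + A * τ) ^ α * r ^ lam) t
      = K * (1 + A * t) ^ α * α * A * (1 + A * t)⁻¹ * r ^ lam := by
    have h0 : HasDerivAt (fun τ : ℝ => 1 + A * τ) A t := by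
      simpa using ((hasDerivAt_id t).const_mul A).const_add 1
    have h1 := ((h0.rpow_const (p := α) (Or.inl hT.ne')).const_mul K).mul_const (r ^ lam)
    rw [h1.deriv, Real.rpow_sub_one hT.ne']
    ring
  have hM : 1 ≤ K * (1 + A * t) ^ α :=
    one_le_mul_of_one_le_of_one_le hK (Real.one_le_rpow hT1 hα.le)
  rw [hd1]
  generalize K * (1 + A * t) ^ α = M at hM
  have hM0 : 0 < M := by linarith
  have hd2 : ∀ s : ℝ, 0 < s → deriv (fun s : ℝ => M * s ^ lam) s = M * lam * s ^ (lam - 1) := by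
    intro s hs
    rw [((Real.hasDerivAt_rpow_const (p := lam) (Or.inl hs.ne')).const_mul M).deriv]
    ring
  have hd3 : deriv (fun s : ℝ => s ^ ((n : ℝ) - 1)
      * (deriv (fun s' : ℝ => M * s' ^ lam) s) ^ (p - 1)) r
      = (M * lam) ^ (p - 1) * (-c * r ^ (-c - 1)) := by
    have he : (fun s : ℝ => s ^ ((n : ℝ) - 1)
      * (deriv (fun s' : ℝ => M * s' ^ lam) s) ^ (p - 1)) =ᶠ[nhds r]
        fun s => (M * lam) ^ (p - 1) * s ^ (-c) := by
      filter_upwards [lt_mem_nhds hr] with s hs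
      rw [hd2 s hs, Real.mul_rpow (by positivity) (by positivity), ← Real.rpow_mul hs.le,
        mul_left_comm, ← Real.rpow_add hs]
      congr 2
      rw [hcdef]; ring
    rw [he.deriv_eq]
    exact ((Real.hasDerivAt_rpow_const (p := -c) (Or.inl hr.ne')).const_mul _).deriv
  rw [hd3, hd2 r hr]
  have hTi : 0 < (1 + A * t)⁻¹ := by positivity
  have hTi1 : (1 + A * t)⁻¹ ≤ 1 := inv_le_one_of_one_le₀ hT1
  generalize (1 + A * t)⁻¹ = T at hTi hTi1
  have hR : 0 < r ^ (lam - 1) := by positivity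
  have hrl : r ^ lam = r ^ (lam - 1) * r := by
    rw [← Real.rpow_add_one hr.ne']; congr 1; ring
  rcases le_or_gt 1 r with h | h
  · have h1 : C * lam ≤ α := (le_div_iff₀ hlam0).mp hC1
    have h2 : 0 ≤ r ^ (1 - (n:ℝ)) * ((M * lam) ^ (p - 1) * (c * r ^ (-c - 1))) := by positivity
    have h3 : 1 ≤ A * r := one_le_mul_of_one_le_of_one_le hA h
    have h4 : C * lam ≤ α * (A * r) := by nlinarith
    have h5 := mul_le_mul_of_nonneg_left h4 (by positivity : 0 ≤ M * T * r ^ (lam - 1))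
    rw [hrl]
    linarith
  · have h1 : 0 ≤ M * α * A * T * r ^ lam := by positivity
    have h2 : r ^ (1 - (n:ℝ)) * r ^ (-c - 1)
        = r ^ ((lam - 1) * (p - 2) - 1) * r ^ (lam - 1) := by
      rw [← Real.rpow_add hr, ← Real.rpow_add hr, hcdef]
      congr 1; ring
    have h3 : 1 ≤ r ^ ((lam - 1) * (p - 2) - 1) :=
      Real.one_le_rpow_of_pos_of_le_one_of_nonpos hr h.le (by nlinarith)
    have h4 : (M * lam) ^ (p - 1) = M ^ (p - 2) * lam ^ (p - 2) * (M * lam) := by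
      rw [← Real.mul_rpow hM0.le hlam0.le, ← Real.rpow_add_one (by positivity)]
      congr 1; ring
    have h5 : 1 ≤ M ^ (p - 2) := Real.one_le_rpow hM (by linarith)
    have h6 : 1 ≤ M ^ (p - 2) * r ^ ((lam - 1) * (p - 2) - 1) :=
      one_le_mul_of_one_le_of_one_le h5 h3
    have h7 : C * T ≤ c * lam ^ (p - 2) * (M ^ (p - 2) * r ^ ((lam - 1) * (p - 2) - 1)) := by
      have : 0 < c * lam ^ (p - 2) := by positivity
      nlinarith
    have h8 := mul_le_mul_of_nonneg_right h7 (by positivity : 0 ≤ M * lam * r ^ (lam - 1))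
    have h9 : r ^ (1 - (n:ℝ)) * ((M * lam) ^ (p - 1) * (-c * r ^ (-c - 1)))
        = -(c * lam ^ (p - 2) * (M ^ (p - 2) * r ^ ((lam - 1) * (p - 2) - 1))
          * (M * lam * r ^ (lam - 1))) := by
      rw [h4]
      linear_combination (-(M ^ (p - 2) * lam ^ (p - 2) * (M * lam)) * c) * h2
    rw [h9]
    linarith
end

section
/- Let n ≥ 2 be an integer, p > n, and let λ, λ' satisfy 0 < λ < (p−n)/(p−1) < λ' < 1; set θ := 1/(p−1−(p−2)λ') and R := λ'/λ. Then for every K ≥ 1 there exist C_ξ ∈ (0,1) and A₀ > 1 such that for all A ≥ A₀, t ≥ 0 and r > (1+At)^θ, the function w(s,τ) := K (1+R)^{−λ'} ( s + R (1+Aτ)^θ )^{λ'} satisfies ∂_τ w(r,t) − r^{1−n} · d/ds[ s^{n−1} (∂_s w(s,t))^{p−1} ]|_{s=r} − C_ξ (1+At)^{−1} ∂_r w(r,t) ≥ 0. Here ∂_s w(s,t) = K λ' (1+R)^{−λ'} (s + R(1+At)^θ)^{λ'−1} > 0. -/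
/-- The outer barrier `w(s,τ) = K (1+R)^{-λ'} (s + R(1+Aτ)^θ)^{λ'}` is a radial
supersolution of `∂_t v = Δ_p v + b(t)·∇v` for any drift with `|b(t)| ≤ C_ξ (1+At)^{-1}`,
in the region `r > (1+At)^θ`, for `A` large enough, where `θ = 1/(p-1-(p-2)λ')`,
`R = λ'/λ` and `0 < λ < (p-n)/(p-1) < λ' < 1`. -/
theorem outer_supersolution (n : ℕ) (p lam lam' θ R : ℝ)
    (hn : 2 ≤ n) (hp : (n : ℝ) < p)
    (hlam0 : 0 < lam) (hlam1 : lam < (p - n) / (p - 1))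
    (hlam2 : (p - n) / (p - 1) < lam') (hlam3 : lam' < 1)
    (hθ : θ = 1 / (p - 1 - (p - 2) * lam')) (hR : R = lam' / lam) :
    ∀ K : ℝ, 1 ≤ K →
      ∃ Cξ A₀ : ℝ, 0 < Cξ ∧ Cξ < 1 ∧ 1 < A₀ ∧
        ∀ A t r : ℝ, A₀ ≤ A → 0 ≤ t → (1 + A * t) ^ θ < r →
          0 ≤ deriv (fun τ : ℝ =>
                  K * (1 + R) ^ (-lam') * (r + R * (1 + A * τ) ^ θ) ^ lam') t
              - r ^ (1 - (n : ℝ))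
                  * deriv (fun s : ℝ => s ^ ((n : ℝ) - 1)
                      * (deriv (fun s' : ℝ =>
                          K * (1 + R) ^ (-lam')
                            * (s' + R * (1 + A * t) ^ θ) ^ lam') s) ^ (p - 1)) r
              - Cξ * (1 + A * t)⁻¹
                  * deriv (fun s : ℝ =>
                      K * (1 + R) ^ (-lam') * (s + R * (1 + A * t) ^ θ) ^ lam') r := by
  have hn2 : (2:ℝ) ≤ n := by exact_mod_cast hn
  have hp2 : 0 < p - 2 := by linarith
  have hL0 : 0 < lam' := by linarith
  have hR0 : 0 < R := by rw [hR]; positivity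
  have hq : 0 < (p - 2) * (1 - lam') := mul_pos hp2 (by linarith)
  have hden : 1 < p - 1 - (p - 2) * lam' := by nlinarith
  have hθ0 : 0 < θ := by rw [hθ]; positivity
  have hθ1 : θ * (p - 1 - (p - 2) * lam') = 1 := by
    rw [hθ]; field_simp
  intro K hK
  set c : ℝ := K * (1 + R) ^ (-lam') with hc
  have hc0 : 0 < c := by positivity
  set M : ℝ := (c * lam') ^ (p - 2) with hM
  have hM0 : 0 < M := by positivity
  have hn1 : (0:ℝ) < n - 1 := by linarith
  refine ⟨1/2, 2 + (M * (n - 1) + 1) / (R * θ), by norm_num, by norm_num, ?_, ?_⟩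
  · have : 0 < (M * (n - 1) + 1) / (R * θ) := by positivity
    linarith
  intro A t r hA ht hr
  have hA2 : 0 < (M * (n - 1) + 1) / (R * θ) := by positivity
  have hA0 : 0 < A := by linarith
  have hA1 : M * (n - 1) + 1 ≤ A * (R * θ) := by
    rw [← div_le_iff₀ (by positivity)]; linarith
  have hT1 : 1 ≤ 1 + A * t := by nlinarith
  have hTd : HasDerivAt (fun τ : ℝ => 1 + A * τ) A t := by
    simpa using ((hasDerivAt_id t).const_mul A).const_add 1
  generalize hTdef : 1 + A * t = T at *
  have hT0 : 0 < T := by linarith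
  have hTθ : 0 < T ^ θ := by positivity
  have hr0 : 0 < r := hTθ.trans hr
  set D : ℝ := R * T ^ θ with hD
  have hD0 : 0 < D := by positivity
  have key : ∀ s : ℝ, 0 < s → HasDerivAt (fun s : ℝ => c * (s + D) ^ lam')
      (c * (lam' * (s + D) ^ (lam' - 1))) s := by
    intro s hs
    have h := (((hasDerivAt_id s).add_const D).rpow_const (p := lam')
      (Or.inl (by simp; positivity))).const_mul c
    exact h.congr_deriv (by simp only [id]; ring)
  have h1 : HasDerivAt (fun τ : ℝ => c * (r + R * (1 + A * τ) ^ θ) ^ lam')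
      (c * (R * (A * θ * T ^ (θ - 1)) * lam' * (r + D) ^ (lam' - 1))) t := by
    have h := ((((hTd.rpow_const (p := θ) (Or.inl (by rw [hTdef]; positivity))).const_mul
      R).const_add r).rpow_const (p := lam')
      (Or.inl (by rw [hTdef]; positivity))).const_mul c
    rw [hTdef] at h
    exact h
  have hev : (fun s : ℝ => s ^ ((n : ℝ) - 1)
      * (deriv (fun s' : ℝ => c * (s' + D) ^ lam') s) ^ (p - 1)) =ᶠ[nhds r]
      (fun s : ℝ => s ^ ((n : ℝ) - 1) * (c * (lam' * (s + D) ^ (lam' - 1))) ^ (p - 1)) := by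
    filter_upwards [lt_mem_nhds hr0] with s hs
    rw [(key s hs).deriv]
  have hx0 : 0 < r + D := by positivity
  set G : ℝ := c * (lam' * (r + D) ^ (lam' - 1)) with hG
  have hG0 : 0 < G := by positivity
  have hg : HasDerivAt (fun s : ℝ => c * (lam' * (s + D) ^ (lam' - 1)))
      (c * (lam' * ((lam' - 1) * (r + D) ^ (lam' - 1 - 1)))) r := by
    have h := ((((hasDerivAt_id r).add_const D).rpow_const (p := lam' - 1)
      (Or.inl (by simp; positivity))).const_mul lam').const_mul c
    exact h.congr_deriv (by simp only [id]; ring)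
  set G' : ℝ := c * (lam' * ((lam' - 1) * (r + D) ^ (lam' - 1 - 1))) with hG'
  have hG'0 : G' ≤ 0 := by
    have : 0 < c * lam' * (r + D) ^ (lam' - 1 - 1) := by positivity
    nlinarith
  have h2 := (Real.hasDerivAt_rpow_const (x := r) (p := (n:ℝ) - 1) (Or.inl hr0.ne')).mul
    (hg.rpow_const (p := p - 1) (Or.inl hG0.ne'))
  rw [h1.deriv, (key r hr0).deriv, hev.deriv_eq]
  erw [h2.deriv]
  rw [← hG]
  have e1 : r ^ (1 - (n:ℝ)) * r ^ ((n:ℝ) - 1 - 1) = r⁻¹ := by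
    rw [← Real.rpow_add hr0, ← Real.rpow_neg_one]; congr 1; ring
  have e2 : r ^ (1 - (n:ℝ)) * r ^ ((n:ℝ) - 1) = 1 := by
    rw [← Real.rpow_add hr0]; simp
  have e3 : G ^ (p - 1) = G * G ^ (p - 2) := by
    rw [← Real.rpow_one_add' hG0.le (by linarith)]; congr 1; ring
  have e4 : G ^ (p - 2) = M * (r + D) ^ ((lam' - 1) * (p - 2)) := by
    rw [hG, ← mul_assoc, Real.mul_rpow (by positivity) (by positivity), Real.rpow_mul hx0.le]
  have e5 : (r + D) ^ ((lam' - 1) * (p - 2)) ≤ (T ^ θ) ^ ((lam' - 1) * (p - 2)) :=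
    Real.rpow_le_rpow_of_nonpos hTθ (by linarith) (by nlinarith)
  have e6 : r⁻¹ ≤ (T ^ θ)⁻¹ := inv_anti₀ hTθ hr.le
  have e7 : (T ^ θ) ^ ((lam' - 1) * (p - 2)) * (T ^ θ)⁻¹ = T⁻¹ := by
    rw [← Real.rpow_neg_one (T ^ θ), ← Real.rpow_add hTθ, ← Real.rpow_mul hT0.le,
      ← Real.rpow_neg_one T]
    congr 1; linarith
  have e8 : (r + D) ^ ((lam' - 1) * (p - 2)) * r⁻¹ ≤ T⁻¹ := by
    rw [← e7]; gcongr
  have e9 : T⁻¹ ≤ T ^ (θ - 1) := by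
    rw [← Real.rpow_neg_one]
    exact Real.rpow_le_rpow_of_exponent_le hT1 (by linarith)
  have e10 : r ^ (1 - (n:ℝ)) * (((n:ℝ) - 1) * r ^ ((n:ℝ) - 1 - 1) * G ^ (p - 1)
      + r ^ ((n:ℝ) - 1) * (G' * (p - 1) * G ^ (p - 1 - 1))) ≤ G * (M * (n - 1) * T⁻¹) := by
    have a1 : r ^ (1 - (n:ℝ)) * (((n:ℝ) - 1) * r ^ ((n:ℝ) - 1 - 1) * G ^ (p - 1)
      + r ^ ((n:ℝ) - 1) * (G' * (p - 1) * G ^ (p - 1 - 1)))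
      = G * (M * (n - 1) * ((r + D) ^ ((lam' - 1) * (p - 2)) * r⁻¹))
        + G' * ((p - 1) * G ^ (p - 1 - 1)) := by
      rw [← e1, e3, e4]
      linear_combination (G' * ((p - 1) * G ^ (p - 1 - 1))) * e2
    have a2 : G' * ((p - 1) * G ^ (p - 1 - 1)) ≤ 0 :=
      mul_nonpos_of_nonpos_of_nonneg hG'0 (mul_nonneg (by linarith) (by positivity))
    have a3 : G * (M * (n - 1) * ((r + D) ^ ((lam' - 1) * (p - 2)) * r⁻¹))
      ≤ G * (M * (n - 1) * T⁻¹) := by gcongr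
    linarith
  have e11 : c * (R * (A * θ * T ^ (θ - 1)) * lam' * (r + D) ^ (lam' - 1))
      = G * (A * (R * θ) * T ^ (θ - 1)) := by rw [hG]; ring
  have e12 : G * ((M * (n - 1) + 1) * T⁻¹) ≤ G * (A * (R * θ) * T ^ (θ - 1)) := by gcongr
  have e13 : 0 < G * T⁻¹ := by positivity
  rw [e11]
  have e14 : G * ((M * (n - 1) + 1) * T⁻¹) = G * (M * (n - 1) * T⁻¹) + G * T⁻¹ := by ring
  have e15 : 1 / 2 * T⁻¹ * G = G * T⁻¹ / 2 := by ring
  rw [e15]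
  linarith
end

section
/- Let λ, λ', k' be real numbers with 0 < λ < λ' < 1 and k' > 0. Let K be a real number with K ≥ max{ 2^{λ'−λ}/k', (2λ'/λ)^{λ} · 2^{λ'−λ}/k' }, let σ ∈ (0,1), set δ := (2λ'−λ)σ/(2λ') (so 0 < δ < σ), and let m ∈ (0,1]. Define v⁻ : [0,∞) → ℝ by v⁻(r) = K⁻¹ m r^{λ'} for 0 ≤ r ≤ σ, and v⁻(r) = K⁻¹ σ^{λ'} (σ−δ)^{−λ} m (r−δ)^{λ} for r > σ. Then 0 ≤ v⁻(r) ≤ k' r^{λ'} (1+r)^{λ−λ'} for all r ≥ 0. -/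
/-- The radial subsolution barrier `v⁻` (inner profile `K⁻¹ m r^{λ'}` for `r ≤ σ`,
outer profile `K⁻¹ σ^{λ'} (σ-δ)^{-λ} m (r-δ)^{λ}` for `r > σ`, with
`δ = (2λ'-λ)σ/(2λ')`) satisfies `0 ≤ v⁻(r) ≤ k' r^{λ'} (1+r)^{λ-λ'}` for all `r ≥ 0`,
provided `K ≥ max { 2^{λ'-λ}/k', (2λ'/λ)^λ · 2^{λ'-λ}/k' }`, `σ ∈ (0,1)`, `m ∈ (0,1]`. -/
theorem subsolution_ordering (lam lam' k' K σ δ m : ℝ)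
    (hlam : 0 < lam) (hlam' : lam < lam') (hlam1 : lam' < 1) (hk' : 0 < k')
    (hK : max (2 ^ (lam' - lam) / k') ((2 * lam' / lam) ^ lam * (2 ^ (lam' - lam) / k')) ≤ K)
    (hσ : σ ∈ Set.Ioo (0 : ℝ) 1) (hδ : δ = (2 * lam' - lam) * σ / (2 * lam'))
    (hm : m ∈ Set.Ioc (0 : ℝ) 1) (v : ℝ → ℝ)
    (hin : ∀ r : ℝ, 0 ≤ r → r ≤ σ → v r = K⁻¹ * m * r ^ lam')
    (hout : ∀ r : ℝ, σ < r → v r = K⁻¹ * σ ^ lam' * (σ - δ) ^ (-lam) * m * (r - δ) ^ lam) :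
    ∀ r : ℝ, 0 ≤ r → 0 ≤ v r ∧ v r ≤ k' * r ^ lam' * (1 + r) ^ (lam - lam') := by
  intro r hr
  obtain ⟨hσ0, hσ1⟩ := hσ
  obtain ⟨hm0, hm1⟩ := hm
  have hl'0 : 0 < lam' := hlam.trans hlam'
  have hd : 0 < lam' - lam := by linarith
  have ha : (0 : ℝ) < 2 ^ (lam' - lam) := by positivity
  have hC : 0 < (2 * lam' / lam) ^ lam := by positivity
  have hK1 := (le_max_left _ _).trans hK
  have hK2 := (le_max_right _ _).trans hK
  have hK0 : 0 < K := lt_of_lt_of_le (by positivity) hK1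
  have e : (1 + r) ^ (lam - lam') = ((1 + r) ^ (lam' - lam))⁻¹ := by
    rw [← Real.rpow_neg (by linarith)]; congr 1; ring
  have hb : 0 < (1 + r) ^ (lam' - lam) := by positivity
  rw [e]
  rcases le_or_gt r σ with h | h
  · rw [hin r hr h]
    refine ⟨by positivity, ?_⟩
    have hba : (1 + r) ^ (lam' - lam) ≤ 2 ^ (lam' - lam) :=
      Real.rpow_le_rpow (by linarith) (by linarith) hd.le
    have h1 : K⁻¹ ≤ k' * ((1 + r) ^ (lam' - lam))⁻¹ := by
      rw [div_le_iff₀ hk'] at hK1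
      rw [← div_eq_mul_inv, le_div_iff₀ hb, inv_mul_le_iff₀ hK0]
      linarith
    have h2 : K⁻¹ * m ≤ K⁻¹ := mul_le_of_le_one_right (by positivity) hm1
    calc K⁻¹ * m * r ^ lam' ≤ (k' * ((1 + r) ^ (lam' - lam))⁻¹) * r ^ lam' := by
          exact mul_le_mul_of_nonneg_right (h2.trans h1) (by positivity)
      _ = _ := by ring
  · rw [hout r h]
    have hr0 : 0 < r := hσ0.trans h
    have hsd : σ - δ = (2 * lam' / lam)⁻¹ * σ := by
      rw [hδ]; field_simp; ring
    have hsd0 : 0 < σ - δ := by rw [hsd]; positivity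
    have hδ0 : 0 ≤ δ := by
      rw [hδ]
      have : 0 < 2 * lam' - lam := by linarith
      positivity
    have hrd : 0 < r - δ := by linarith
    refine ⟨by positivity, ?_⟩
    have e2 : (σ - δ) ^ (-lam) = (2 * lam' / lam) ^ lam * σ ^ (-lam) := by
      rw [hsd, Real.mul_rpow (by positivity) hσ0.le, Real.inv_rpow (by positivity),
        Real.rpow_neg (by positivity), inv_inv]
    have e3 : σ ^ lam' * σ ^ (-lam) = σ ^ (lam' - lam) := by
      rw [← Real.rpow_add hσ0]; congr 1
    have e4 : r ^ lam' = r ^ (lam' - lam) * r ^ lam := by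
      rw [← Real.rpow_add hr0]; congr 1; ring
    have h1 : K⁻¹ * (2 * lam' / lam) ^ lam ≤ k' * (2 ^ (lam' - lam))⁻¹ := by
      rw [← mul_div_assoc, div_le_iff₀ hk'] at hK2
      rw [← div_eq_mul_inv, le_div_iff₀ ha, mul_assoc, inv_mul_le_iff₀ hK0]
      exact hK2
    have h3 : σ ^ (lam' - lam) * (1 + r) ^ (lam' - lam) ≤ 2 ^ (lam' - lam) * r ^ (lam' - lam) := by
      rw [← Real.mul_rpow hσ0.le (by linarith), ← Real.mul_rpow (by norm_num) hr]
      exact Real.rpow_le_rpow (by positivity) (by nlinarith) hd.le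
    have h4 : (2 ^ (lam' - lam))⁻¹ * σ ^ (lam' - lam)
        ≤ r ^ (lam' - lam) * ((1 + r) ^ (lam' - lam))⁻¹ := by
      rw [← div_eq_mul_inv, le_div_iff₀ hb, mul_assoc, inv_mul_le_iff₀ ha]
      exact h3
    have h5 : (r - δ) ^ lam ≤ r ^ lam := Real.rpow_le_rpow hrd.le (by linarith) hlam.le
    calc K⁻¹ * σ ^ lam' * (σ - δ) ^ (-lam) * m * (r - δ) ^ lam
        = (K⁻¹ * (2 * lam' / lam) ^ lam) * (σ ^ lam' * σ ^ (-lam)) * m * (r - δ) ^ lam := by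
          rw [e2]; ring
      _ ≤ (k' * (2 ^ (lam' - lam))⁻¹) * σ ^ (lam' - lam) * 1 * r ^ lam := by
          rw [e3]; gcongr
      _ = k' * ((2 ^ (lam' - lam))⁻¹ * σ ^ (lam' - lam)) * r ^ lam := by ring
      _ ≤ k' * (r ^ (lam' - lam) * ((1 + r) ^ (lam' - lam))⁻¹) * r ^ lam := by gcongr
      _ = _ := by rw [e4]; ring
end

section
/- Let n ≥ 2 be an integer, p > n (hence p > 2), and let λ' satisfy (p−n)/(p−1) < λ' < 1. Let K ≥ 1 and C_ξ ∈ (0,1). Then there exists σ ∈ (0,1) such that for all A ≥ 1, t ≥ 0 and 0 < r ≤ σ, the function w(s,τ) := K⁻¹ (1+Aτ)^{−1/(p−2)} s^{λ'} satisfies ∂_τ w(r,t) − r^{1−n} · d/ds[ s^{n−1} (∂_s w(s,t))^{p−1} ]|_{s=r} + C_ξ (1+At)^{−1} ∂_r w(r,t) ≤ 0. Here ∂_s w(s,t) = K⁻¹ (1+At)^{−1/(p−2)} λ' s^{λ'−1} > 0. -/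
/-- The inner barrier `w(s,τ) = K⁻¹ (1+Aτ)^{-1/(p-2)} s^{λ'}` is a radial subsolution of
`∂_t v = Δ_p v + b(t)·∇v` for any drift with `|b(t)| ≤ C_ξ (1+At)^{-1}`, in a region
`0 < r ≤ σ` for some small `σ ∈ (0,1)`, where `(p-n)/(p-1) < λ' < 1` and `p > n ≥ 2`. -/
theorem inner_subsolution (n : ℕ) (p lam' K Cξ : ℝ)
    (hn : 2 ≤ n) (hp : (n : ℝ) < p)
    (hlam2 : (p - n) / (p - 1) < lam') (hlam3 : lam' < 1)
    (hK : 1 ≤ K) (hCξ : Cξ ∈ Set.Ioo (0 : ℝ) 1) :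
    ∃ σ : ℝ, σ ∈ Set.Ioo (0 : ℝ) 1 ∧
      ∀ A t r : ℝ, 1 ≤ A → 0 ≤ t → 0 < r → r ≤ σ →
        deriv (fun τ : ℝ => K⁻¹ * (1 + A * τ) ^ (-(1 / (p - 2))) * r ^ lam') t
            - r ^ (1 - (n : ℝ))
                * deriv (fun s : ℝ => s ^ ((n : ℝ) - 1)
                    * (deriv (fun s' : ℝ =>
                        K⁻¹ * (1 + A * t) ^ (-(1 / (p - 2))) * s' ^ lam') s) ^ (p - 1)) r
            + Cξ * (1 + A * t)⁻¹
                * deriv (fun s : ℝ => K⁻¹ * (1 + A * t) ^ (-(1 / (p - 2))) * s ^ lam') r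
          ≤ 0 := by
  obtain ⟨hC0, hC1⟩ := hCξ
  have hn' : (2 : ℝ) ≤ n := by exact_mod_cast hn
  have hp1 : 0 < p - 1 := by linarith
  have hp2 : 0 < p - 2 := by linarith
  have hK0 : 0 < K := by linarith
  have hl0 : 0 < lam' := lt_trans (div_pos (by linarith) hp1) hlam2
  have hlam : p - n < lam' * (p - 1) := (div_lt_iff₀ hp1).1 hlam2
  obtain ⟨e, he⟩ : ∃ e : ℝ, e = (n : ℝ) - 1 + (lam' - 1) * (p - 1) := ⟨_, rfl⟩
  have he0 : 0 < e := by rw [he]; nlinarith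
  obtain ⟨c, hc⟩ : ∃ c : ℝ, c = (K⁻¹ * lam') ^ (p - 2) * e := ⟨_, rfl⟩
  have hc0 : 0 < c := by rw [hc]; positivity
  refine ⟨min (1 / 2) c, ⟨lt_min (by norm_num) hc0,
    lt_of_le_of_lt (min_le_left _ _) (by norm_num)⟩, ?_⟩
  intro A t r hA ht hr hrσ
  have hrc : r ≤ c := hrσ.trans (min_le_right _ _)
  have hr1 : r ≤ 1 := (hrσ.trans (min_le_left _ _)).trans (by norm_num)
  have hB : 0 < 1 + A * t := by
    have : 0 ≤ A * t := mul_nonneg (by linarith) ht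
    linarith
  have h1 : deriv (fun τ : ℝ => K⁻¹ * (1 + A * τ) ^ (-(1 / (p - 2))) * r ^ lam') t ≤ 0 := by
    have hd : HasDerivAt (fun τ : ℝ => 1 + A * τ) A t := by
      simpa using ((hasDerivAt_id t).const_mul A).const_add 1
    have hd2 := ((hd.rpow_const (p := -(1 / (p - 2))) (Or.inl hB.ne')).const_mul K⁻¹).mul_const
      (r ^ lam')
    rw [hd2.deriv]
    have : 0 ≤ K⁻¹ * (A * (1 / (p - 2)) * (1 + A * t) ^ (-(1 / (p - 2)) - 1)) * r ^ lam' := by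
      have : 0 ≤ A := by linarith
      positivity
    linarith
  obtain ⟨g, hg⟩ : ∃ g : ℝ, g = K⁻¹ * (1 + A * t) ^ (-(1 / (p - 2))) := ⟨_, rfl⟩
  have hg0 : 0 < g := by rw [hg]; positivity
  have hgp : (g * lam') ^ (p - 2) * e = c * (1 + A * t)⁻¹ := by
    have h : ((1 + A * t) ^ (-(1 / (p - 2)))) ^ (p - 2) = (1 + A * t)⁻¹ := by
      rw [← Real.rpow_mul hB.le, show -(1 / (p - 2)) * (p - 2) = -1 by field_simp,
        Real.rpow_neg_one]
    rw [hg, hc, mul_right_comm, Real.mul_rpow (by positivity) (by positivity), h]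
    ring
  rw [← hg]
  have h2 : ∀ s : ℝ, 0 < s → deriv (fun s : ℝ => g * s ^ lam') s = g * lam' * s ^ (lam' - 1) := by
    intro s hs
    rw [((Real.hasDerivAt_rpow_const (p := lam') (Or.inl hs.ne')).const_mul g).deriv]
    ring
  have h3 : deriv (fun s : ℝ => s ^ ((n : ℝ) - 1)
      * (deriv (fun s' : ℝ => g * s' ^ lam') s) ^ (p - 1)) r
      = (g * lam') ^ (p - 1) * (e * r ^ (e - 1)) := by
    have hev : (fun s : ℝ => s ^ ((n : ℝ) - 1)
      * (deriv (fun s' : ℝ => g * s' ^ lam') s) ^ (p - 1)) =ᶠ[nhds r]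
        fun s => (g * lam') ^ (p - 1) * s ^ e := by
      filter_upwards [lt_mem_nhds hr] with s hs
      rw [h2 s hs, Real.mul_rpow (by positivity) (by positivity), ← Real.rpow_mul hs.le, he,
        Real.rpow_add hs]
      ring
    rw [hev.deriv_eq,
      ((Real.hasDerivAt_rpow_const (p := e) (Or.inl hr.ne')).const_mul _).deriv]
  rw [h3, h2 r hr]
  have h4 : r ^ (1 - (n : ℝ)) * ((g * lam') ^ (p - 1) * (e * r ^ (e - 1)))
      = (g * lam' * r ^ (lam' - 1) * (1 + A * t)⁻¹) *
        (c * r⁻¹ * r ^ ((lam' - 1) * (p - 2))) := by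
    have ha : (g * lam') ^ (p - 1) = (g * lam') ^ (p - 2) * (g * lam') := by
      rw [← Real.rpow_add_one (by positivity)]; congr 1; ring
    have hb : r ^ (1 - (n : ℝ)) * r ^ (e - 1)
        = r ^ (lam' - 1) * r⁻¹ * r ^ ((lam' - 1) * (p - 2)) := by
      rw [← Real.rpow_neg_one r, ← Real.rpow_add hr, ← Real.rpow_add hr, ← Real.rpow_add hr, he]
      congr 1; ring
    calc _ = ((g * lam') ^ (p - 2) * e) * (g * lam') * (r ^ (1 - (n : ℝ)) * r ^ (e - 1)) := by
          rw [ha]; ring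
      _ = _ := by rw [hgp, hb]; ring
  rw [h4]
  have h5 : 1 ≤ r ^ ((lam' - 1) * (p - 2)) :=
    Real.one_le_rpow_of_pos_of_le_one_of_nonpos hr hr1 (by nlinarith)
  have h6 : 1 ≤ c * r⁻¹ := by
    rw [← div_eq_mul_inv]; exact (one_le_div hr).2 hrc
  have h7 : 1 ≤ c * r⁻¹ * r ^ ((lam' - 1) * (p - 2)) := one_le_mul_of_one_le_of_one_le h6 h5
  have h8 : 0 < g * lam' * r ^ (lam' - 1) * (1 + A * t)⁻¹ := by positivity
  have h9 := mul_le_mul_of_nonneg_left (hC1.le.trans h7) h8.le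
  have h10 : Cξ * (1 + A * t)⁻¹ * (g * lam' * r ^ (lam' - 1))
      = g * lam' * r ^ (lam' - 1) * (1 + A * t)⁻¹ * Cξ := by ring
  rw [h10]
  linarith
end

section
/- Let n ≥ 2 be an integer, p > n (hence p > 2), and let λ, λ' satisfy 0 < λ < (p−n)/(p−1) < λ' < 1. Let K ≥ 1, C_ξ ∈ (0,1), σ ∈ (0,1) and set δ := (2λ'−λ)σ/(2λ'). Then there exists A₀ > 1 such that for all A ≥ A₀, t ≥ 0 and r > σ, the function w(s,τ) := K⁻¹ σ^{λ'} (σ−δ)^{−λ} (1+Aτ)^{−1/(p−2)} (s−δ)^{λ} satisfies ∂_τ w(r,t) − r^{1−n} · d/ds[ s^{n−1} (∂_s w(s,t))^{p−1} ]|_{s=r} + C_ξ (1+At)^{−1} ∂_r w(r,t) ≤ 0. Here ∂_s w(s,t) = K⁻¹ σ^{λ'} (σ−δ)^{−λ} (1+At)^{−1/(p−2)} λ (r−δ)^{λ−1} > 0. -/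
/-- The outer barrier `w(s,τ) = K⁻¹ σ^{λ'} (σ-δ)^{-λ} (1+Aτ)^{-1/(p-2)} (s-δ)^{λ}` is a
radial subsolution of `∂_t v = Δ_p v + b(t)·∇v` for any drift with
`|b(t)| ≤ C_ξ (1+At)^{-1}`, in the region `r > σ`, for `A` large enough, where
`δ = (2λ'-λ)σ/(2λ')`, `0 < λ < (p-n)/(p-1) < λ' < 1` and `p > n ≥ 2`. -/
theorem outer_subsolution (n : ℕ) (p lam lam' K Cξ σ δ : ℝ)
    (hn : 2 ≤ n) (hp : (n : ℝ) < p)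
    (hlam0 : 0 < lam) (hlam1 : lam < (p - n) / (p - 1))
    (hlam2 : (p - n) / (p - 1) < lam') (hlam3 : lam' < 1)
    (hK : 1 ≤ K) (hCξ : Cξ ∈ Set.Ioo (0 : ℝ) 1) (hσ : σ ∈ Set.Ioo (0 : ℝ) 1)
    (hδ : δ = (2 * lam' - lam) * σ / (2 * lam')) :
    ∃ A₀ : ℝ, 1 < A₀ ∧
      ∀ A t r : ℝ, A₀ ≤ A → 0 ≤ t → σ < r →
        deriv (fun τ : ℝ =>
              K⁻¹ * σ ^ lam' * (σ - δ) ^ (-lam)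
                * (1 + A * τ) ^ (-(1 / (p - 2))) * (r - δ) ^ lam) t
            - r ^ (1 - (n : ℝ))
                * deriv (fun s : ℝ => s ^ ((n : ℝ) - 1)
                    * (deriv (fun s' : ℝ =>
                        K⁻¹ * σ ^ lam' * (σ - δ) ^ (-lam)
                          * (1 + A * t) ^ (-(1 / (p - 2))) * (s' - δ) ^ lam) s) ^ (p - 1)) r
            + Cξ * (1 + A * t)⁻¹
                * deriv (fun s : ℝ =>
                    K⁻¹ * σ ^ lam' * (σ - δ) ^ (-lam)
                      * (1 + A * t) ^ (-(1 / (p - 2))) * (s - δ) ^ lam) r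
          ≤ 0 := by
  have hn' : (2:ℝ) ≤ n := by exact_mod_cast hn
  have hp2 : 0 < p - 2 := by linarith
  have hp1 : 0 < p - 1 := by linarith
  obtain ⟨hσ0, hσ1⟩ := hσ
  obtain ⟨hC0, hC1⟩ := hCξ
  have hl' : 0 < lam' := by linarith
  have hll : lam < 1 := by linarith
  have hε : 0 < σ - δ := by
    have : σ - δ = lam * σ / (2 * lam') := by rw [hδ]; field_simp; ring
    rw [this]; positivity
  have hCpos : 0 < K⁻¹ * σ ^ lam' * (σ - δ) ^ (-lam) := by positivity
  generalize K⁻¹ * σ ^ lam' * (σ - δ) ^ (-lam) = C at hCpos ⊢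
  have hq : 0 < 1 / (p - 2) := by positivity
  have hqp : -(1 / (p - 2)) * (p - 1) = -(1 / (p - 2)) - 1 := by field_simp; ring
  generalize 1 / (p - 2) = q at hq hqp ⊢
  obtain ⟨m, hm⟩ : ∃ m, m = (lam - 1) * (p - 1) := ⟨_, rfl⟩
  have hm0 : m < 0 := by rw [hm]; exact mul_neg_of_neg_of_pos (by linarith) hp1
  obtain ⟨ε, hεd⟩ : ∃ ε, ε = σ - δ := ⟨_, rfl⟩
  rw [← hεd] at hε
  obtain ⟨M, hM⟩ : ∃ M, M = -m * (C * lam) ^ (p - 1) * ε ^ (m - 1 - lam)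
    + Cξ * (C * lam) * ε⁻¹ := ⟨_, rfl⟩
  have hM0 : 0 < M := by
    rw [hM]
    have : 0 < -m := by linarith
    positivity
  refine ⟨2 + M / (C * q), by have : 0 < M / (C * q) := by positivity
                              linarith, ?_⟩
  intro A t r hA ht hr
  have hA0 : 0 < A := by
    have : 0 < M / (C * q) := by positivity
    linarith
  have hB : 0 < 1 + A * t := by positivity
  have hx : 0 < r - δ := by linarith
  have hεx : ε ≤ r - δ := by linarith
  have hr0 : 0 < r := by linarith
  have hAM : M ≤ C * q * A := by
    have h1 : M / (C * q) ≤ A := by linarith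
    rw [div_le_iff₀ (by positivity)] at h1
    linarith
  -- derivative in time
  have d1 : deriv (fun τ : ℝ => C * (1 + A * τ) ^ (-q) * (r - δ) ^ lam) t
      = -(C * q * A * (1 + A * t) ^ (-q - 1) * (r - δ) ^ lam) := by
    have h0 : HasDerivAt (fun τ : ℝ => 1 + A * τ) A t := by
      simpa using ((hasDerivAt_id t).const_mul A).const_add 1
    have h1 := ((h0.rpow_const (p := -q) (Or.inl hB.ne')).const_mul C).mul_const ((r - δ) ^ lam)
    rw [h1.deriv]; ring
  -- derivative in space
  have d2 : ∀ s : ℝ, 0 < s - δ → deriv (fun s : ℝ => C * (1 + A * t) ^ (-q) * (s - δ) ^ lam) s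
      = C * (1 + A * t) ^ (-q) * lam * (s - δ) ^ (lam - 1) := by
    intro s hs
    have h0 : HasDerivAt (fun s : ℝ => s - δ) 1 s := (hasDerivAt_id s).sub_const δ
    have h1 := (h0.rpow_const (p := lam) (Or.inl hs.ne')).const_mul (C * (1 + A * t) ^ (-q))
    rw [h1.deriv]; ring
  have d3 : deriv (fun s : ℝ => s ^ ((n : ℝ) - 1)
      * (deriv (fun s' : ℝ => C * (1 + A * t) ^ (-q) * (s' - δ) ^ lam) s) ^ (p - 1)) r
      = (C * lam) ^ (p - 1) * (1 + A * t) ^ (-q - 1) *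
        (((n : ℝ) - 1) * r ^ ((n : ℝ) - 1 - 1) * (r - δ) ^ m
          + r ^ ((n : ℝ) - 1) * (m * (r - δ) ^ (m - 1))) := by
    have he : (fun s : ℝ => s ^ ((n : ℝ) - 1)
      * (deriv (fun s' : ℝ => C * (1 + A * t) ^ (-q) * (s' - δ) ^ lam) s) ^ (p - 1))
      =ᶠ[nhds r] fun s => (C * lam) ^ (p - 1) * (1 + A * t) ^ (-q - 1) *
        (s ^ ((n : ℝ) - 1) * (s - δ) ^ m) := by
      filter_upwards [lt_mem_nhds (show δ < r by linarith)] with s hs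
      have hs' : 0 < s - δ := by linarith
      rw [d2 s hs', show C * (1 + A * t) ^ (-q) * lam * (s - δ) ^ (lam - 1)
        = (C * lam) * (1 + A * t) ^ (-q) * (s - δ) ^ (lam - 1) by ring,
        Real.mul_rpow (by positivity) (by positivity),
        Real.mul_rpow (by positivity) (by positivity),
        ← Real.rpow_mul hB.le, ← Real.rpow_mul hs'.le, hqp, ← hm]
      ring
    rw [he.deriv_eq]
    have h0 : HasDerivAt (fun s : ℝ => s - δ) 1 r := (hasDerivAt_id r).sub_const δ
    have h1 := h0.rpow_const (p := m) (Or.inl hx.ne')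
    have h2 := Real.hasDerivAt_rpow_const (x := r) (p := (n : ℝ) - 1) (Or.inl hr0.ne')
    have h3 := (h2.mul h1).const_mul ((C * lam) ^ (p - 1) * (1 + A * t) ^ (-q - 1))
    refine h3.deriv.trans ?_
    ring
  rw [d1, d3, d2 r hx]
  have e1 : (1 + A * t)⁻¹ * (1 + A * t) ^ (-q) = (1 + A * t) ^ (-q - 1) := by
    rw [Real.rpow_sub_one hB.ne']; field_simp
  have e2 : r ^ (1 - (n : ℝ)) * r ^ ((n : ℝ) - 1) = 1 := by
    rw [← Real.rpow_add hr0]; simp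
  have f1 : (r - δ) ^ (m - 1) ≤ (r - δ) ^ lam * ε ^ (m - 1 - lam) := by
    have : (r - δ) ^ (m - 1) = (r - δ) ^ lam * (r - δ) ^ (m - 1 - lam) := by
      rw [← Real.rpow_add hx]; congr 1; ring
    rw [this]
    exact mul_le_mul_of_nonneg_left
      (Real.rpow_le_rpow_of_nonpos hε hεx (by linarith)) (by positivity)
  have f2 : (r - δ) ^ (lam - 1) ≤ (r - δ) ^ lam * ε⁻¹ := by
    rw [Real.rpow_sub_one hx.ne', div_eq_mul_inv]
    gcongr
  have f3 : 0 ≤ (C * lam) ^ (p - 1) * (r ^ (1 - (n : ℝ)) *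
      (((n : ℝ) - 1) * r ^ ((n : ℝ) - 1 - 1) * (r - δ) ^ m)) := by
    have : 0 < (n : ℝ) - 1 := by linarith
    positivity
  have g1 : -m * (C * lam) ^ (p - 1) * (r - δ) ^ (m - 1) ≤
      -m * (C * lam) ^ (p - 1) * ((r - δ) ^ lam * ε ^ (m - 1 - lam)) :=
    mul_le_mul_of_nonneg_left f1 (mul_nonneg (by linarith) (by positivity))
  have g2 : Cξ * (C * lam) * (r - δ) ^ (lam - 1) ≤ Cξ * (C * lam) * ((r - δ) ^ lam * ε⁻¹) :=
    mul_le_mul_of_nonneg_left f2 (by positivity)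
  have g3 : M * (r - δ) ^ lam ≤ C * q * A * (r - δ) ^ lam :=
    mul_le_mul_of_nonneg_right hAM (by positivity)
  have key : (1 + A * t) ^ (-q - 1) * (-(C * q * A * (r - δ) ^ lam)
      - (C * lam) ^ (p - 1) * (r ^ (1 - (n : ℝ)) *
      (((n : ℝ) - 1) * r ^ ((n : ℝ) - 1 - 1) * (r - δ) ^ m))
      + -m * (C * lam) ^ (p - 1) * (r - δ) ^ (m - 1)
      + Cξ * (C * lam) * (r - δ) ^ (lam - 1)) ≤ 0 := by
    apply mul_nonpos_of_nonneg_of_nonpos (by positivity)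
    rw [hM] at g3
    linarith
  refine le_of_eq_of_le ?_ key
  linear_combination (Cξ * (C * lam) * (r - δ) ^ (lam - 1)) * e1
    - (C * lam) ^ (p - 1) * (1 + A * t) ^ (-q - 1) * (m * (r - δ) ^ (m - 1)) * e2
end
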